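/- arXiv:2510.12161 — 9 statements merged into one kernel-verified Lean document; each statement's English description precedes it below -/
import Mathlib

section
/- Let X and Y be metric spaces, and suppose X is (ℓ,r)-quasi-geodesic for some ℓ, r ∈ ℝ. If f : X → Y is bornologous, then f is large-scale Lipschitz, i.e., there exist L, C ∈ ℝ such that d(f(p), f(q)) ≤ L·d(p,q) + C for all p, q ∈ X. -/
/-- A metric space `X` is `(ℓ,r)`-quasi-geodesic if every two points `p, q` can be joined
by a finite chain `x 0 = p, …, x k = q` whose consecutive distances are at most `r` and whose
total length is at most `ℓ * dist p q`. -/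
def IsQuasiGeodesicSpace (X : Type*) [MetricSpace X] (ℓ r : ℝ) : Prop :=
  ∀ p q : X, ∃ (k : ℕ) (x : ℕ → X), x 0 = p ∧ x k = q ∧
    (∀ j < k, dist (x j) (x (j + 1)) ≤ r) ∧
    (∑ j ∈ Finset.range k, dist (x j) (x (j + 1))) ≤ ℓ * dist p q

/-- A map between metric spaces is bornologous if, whenever `dist (f (p n)) (f (q n)) → ∞`,
also `dist (p n) (q n) → ∞`. -/
def Bornologous {X Y : Type*} [MetricSpace X] [MetricSpace Y] (f : X → Y) : Prop :=
  ∀ p q : ℕ → X,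
    Filter.Tendsto (fun n => dist (f (p n)) (f (q n))) Filter.atTop Filter.atTop →
    Filter.Tendsto (fun n => dist (p n) (q n)) Filter.atTop Filter.atTop

/-- A bornologous map sends pairs at bounded distance to pairs at bounded distance. -/
theorem Bornologous.exists_dist_le {X Y : Type*} [MetricSpace X] [MetricSpace Y] {f : X → Y}
    (hf : Bornologous f) (S : ℝ) :
    ∃ C : ℝ, 0 ≤ C ∧ ∀ p q : X, dist p q ≤ S → dist (f p) (f q) ≤ C := by
  by_contra! h
  choose p q hS hC using fun n : ℕ => h n n.cast_nonneg
  have hT := hf p q (Filter.tendsto_atTop_mono (fun n => (hC n).le) tendsto_natCast_atTop_atTop)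
  obtain ⟨n, hn⟩ := (hT.eventually_gt_atTop S).exists
  exact (hS n).not_gt hn

/-- If `f` moves points at distance at most `2 * s` to points at distance at most `C`, where
`1 ≤ s`, then along a chain with steps at most `s` the displacement of `f` is bounded affinely
by the length of the chain. -/
theorem dist_map_le_mul_sum_add {X Y : Type*} [MetricSpace X] [MetricSpace Y] {f : X → Y}
    {s C : ℝ} (hs : 1 ≤ s) (hC0 : 0 ≤ C)
    (hC : ∀ p q : X, dist p q ≤ 2 * s → dist (f p) (f q) ≤ C) (x : ℕ → X) (k : ℕ)
    (hx : ∀ j < k, dist (x j) (x (j + 1)) ≤ s) :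
    dist (f (x 0)) (f (x k)) ≤ C * (∑ j ∈ Finset.range k, dist (x j) (x (j + 1))) + C := by
  have key : ∃ (z : X) (t : ℝ), 0 ≤ t ∧ t ≤ s ∧ dist z (x k) ≤ t ∧
      dist (f (x 0)) (f z) ≤ C * ((∑ j ∈ Finset.range k, dist (x j) (x (j + 1))) - t) := by
    induction k with
    | zero => exact ⟨x 0, 0, le_rfl, by linarith, by simp, by simp⟩
    | succ k ih =>
      obtain ⟨z, t, ht0, hts, hz, hfz⟩ := ih fun j hj => hx j (by lia)
      have hd := hx k k.lt_succ_self
      have htri := dist_triangle z (x k) (x (k + 1))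
      rw [Finset.sum_range_succ]
      rcases le_or_gt (t + dist (x k) (x (k + 1))) s with h | h
      · refine ⟨z, t + dist (x k) (x (k + 1)), by positivity, h, by linarith, ?_⟩
        rwa [add_sub_add_right_eq_sub]
      · refine ⟨x (k + 1), 0, le_rfl, by linarith, by simp, ?_⟩
        have h1 := hC z (x (k + 1)) (by linarith)
        have h2 := dist_triangle (f (x 0)) (f z) (f (x (k + 1)))
        have h3 := mul_le_mul_of_nonneg_left (hs.trans h.le) hC0
        linarith
  obtain ⟨z, t, ht0, hts, hz, hfz⟩ := key
  have h1 := hC z (x k) (by linarith)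
  have h2 := dist_triangle (f (x 0)) (f z) (f (x k))
  have h3 := mul_nonneg hC0 ht0
  linarith

/-- If `X` is an `(ℓ,r)`-quasi-geodesic metric space and `f : X → Y` is bornologous,
then `f` is large-scale Lipschitz. -/
theorem bornologous_of_quasiGeodesic_is_largeScaleLipschitz
    {X Y : Type*} [MetricSpace X] [MetricSpace Y]
    (ℓ r : ℝ) (hX : IsQuasiGeodesicSpace X ℓ r)
    (f : X → Y) (hf : Bornologous f) :
    ∃ L C : ℝ, ∀ p q : X, dist (f p) (f q) ≤ L * dist p q + C := by
  obtain ⟨C, hC0, hC⟩ := hf.exists_dist_le (2 * max r 1)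
  refine ⟨C * ℓ, C, fun p q => ?_⟩
  obtain ⟨k, x, rfl, rfl, hr, hsum⟩ := hX p q
  have h1 := dist_map_le_mul_sum_add (le_max_right r 1) hC0 hC x k
    fun j hj => (hr j hj).trans (le_max_left r 1)
  have h2 := mul_le_mul_of_nonneg_left hsum hC0
  linarith
end

section
/- Let X be a Hausdorff topological space and let C ⊆ X be an ∞-continuum. If Y ⊆ X is compact and the interior of Y meets C (int(Y) ∩ C ≠ ∅), then the topological boundary of Y meets C (∂Y ∩ C ≠ ∅). -/
/-- A subset `C` of a topological space is an `∞`-continuum if it is closed and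
no connected component of `C` is compact. -/
def IsInfContinuum {X : Type*} [TopologicalSpace X] (C : Set X) : Prop :=
  IsClosed C ∧ ∀ x ∈ C, ¬ IsCompact (connectedComponentIn C x)

/-- If `C` is an `∞`-continuum in a Hausdorff space and `Y` is compact with
`interior Y ∩ C ≠ ∅`, then `frontier Y ∩ C ≠ ∅`. -/
theorem frontier_inter_infContinuum_nonempty
    {X : Type*} [TopologicalSpace X] [T2Space X] {C Y : Set X}
    (hC : IsInfContinuum C) (hY : IsCompact Y)
    (h : (interior Y ∩ C).Nonempty) :
    (frontier Y ∩ C).Nonempty := by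
  obtain ⟨x, hxY, hxC⟩ := h
  have hxK : x ∈ connectedComponentIn C x := mem_connectedComponentIn hxC
  have hclosed : IsClosed (connectedComponentIn C x) := by
    rw [connectedComponentIn_eq_image hxC]
    exact hC.1.isClosedEmbedding_subtypeVal.isClosedMap _ isClosed_connectedComponent
  obtain ⟨y, hyK, hyY⟩ : ∃ y ∈ connectedComponentIn C x, y ∉ Y := by
    by_contra! hsub
    exact hC.2 x hxC (hY.of_isClosed_subset hclosed hsub)
  by_contra hempty
  have hcover : connectedComponentIn C x ⊆ interior Y ∪ Yᶜ := fun z hz => by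
    by_contra hz'
    simp only [Set.mem_union, Set.mem_compl_iff, not_or, not_not] at hz'
    exact hempty ⟨z, ⟨subset_closure hz'.2, hz'.1⟩, connectedComponentIn_subset C x hz⟩
  obtain ⟨z, -, hz, hz'⟩ := isPreconnected_connectedComponentIn _ _ isOpen_interior
    hY.isClosed.isOpen_compl hcover ⟨x, hxK, hxY⟩ ⟨y, hyK, hyY⟩
  exact hz' (interior_subset hz)
end

section
/- Let X be a Hausdorff topological space, let C ⊆ X be an ∞-continuum, and let u : X → ℝ be a bounded continuous function. Suppose that u is monotone on X ∖ C and that C ⊆ {x ∈ X : u(x) = sup_X u} ∪ {x ∈ X : u(x) = inf_X u}. Then u is monotone on X. -/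
/-- A real-valued function on a topological space is monotone if, for every compact set `K`,
the supremum (resp. infimum) of the function over `K` is attained on the topological boundary
of `K`; suprema and infima are taken in the extended reals, so that `sup ∅ = -∞` and
`inf ∅ = +∞`. -/
def IsMonotoneFn {Z : Type*} [TopologicalSpace Z] (u : Z → ℝ) : Prop :=
  ∀ K : Set Z, IsCompact K →
    (⨆ x ∈ frontier K, (u x : EReal)) = (⨆ x ∈ K, (u x : EReal)) ∧
    (⨅ x ∈ frontier K, (u x : EReal)) = (⨅ x ∈ K, (u x : EReal))

/-- `u` is monotone on `A ⊆ X` if the restriction of `u` to `A`, with the subspace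
topology, is monotone. -/
def IsMonotoneFnOn {X : Type*} [TopologicalSpace X] (u : X → ℝ) (A : Set X) : Prop :=
  IsMonotoneFn (fun a : A => u a)

/-- The weak maximum principle: an upper bound for `u` on the boundary of a compact set is an
upper bound for `u` on the whole compact set. -/
def HasMaxPrinciple {Z : Type*} [TopologicalSpace Z] (u : Z → ℝ) : Prop :=
  ∀ K : Set Z, IsCompact K → ∀ t : ℝ, (∀ y ∈ frontier K, u y ≤ t) → ∀ x ∈ K, u x ≤ t

theorem IsMonotoneFn.hasMaxPrinciple {Z : Type*} [TopologicalSpace Z] {u : Z → ℝ}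
    (h : IsMonotoneFn u) : HasMaxPrinciple u := by
  intro K hK t ht x hx
  have h1 : (⨆ x ∈ K, (u x : EReal)) ≤ t := by
    rw [← (h K hK).1]
    exact iSup₂_le fun y hy => EReal.coe_le_coe_iff.2 (ht y hy)
  exact EReal.coe_le_coe_iff.1 ((le_iSup₂ (f := fun x (_ : x ∈ K) => (u x : EReal)) x hx).trans h1)

theorem IsMonotoneFn.hasMaxPrinciple_neg {Z : Type*} [TopologicalSpace Z] {u : Z → ℝ}
    (h : IsMonotoneFn u) : HasMaxPrinciple (fun z => -u z) := by
  intro K hK t ht x hx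
  have h1 : ((-t : ℝ) : EReal) ≤ ⨅ x ∈ K, (u x : EReal) := by
    rw [← (h K hK).2]
    exact le_iInf₂ fun y hy => EReal.coe_le_coe_iff.2 (neg_le.1 (ht y hy))
  exact neg_le.1 (EReal.coe_le_coe_iff.1
    (h1.trans (iInf₂_le (f := fun x (_ : x ∈ K) => (u x : EReal)) x hx)))

theorem isMonotoneFn_of_hasMaxPrinciple {Z : Type*} [TopologicalSpace Z] [T2Space Z] {u : Z → ℝ}
    (h : HasMaxPrinciple u) (h' : HasMaxPrinciple (fun z => -u z)) : IsMonotoneFn u := by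
  intro K hK
  have hsub : frontier K ⊆ K := hK.isClosed.frontier_subset
  refine ⟨le_antisymm (biSup_mono hsub) ?_, le_antisymm ?_ (biInf_mono hsub)⟩
  · refine EReal.le_of_forall_lt_iff_le.1 fun t ht => ?_
    refine iSup₂_le fun x hx => EReal.coe_le_coe_iff.2 (h K hK t (fun y hy => ?_) x hx)
    exact EReal.coe_le_coe_iff.1
      ((le_iSup₂ (f := fun x (_ : x ∈ frontier K) => (u x : EReal)) y hy).trans ht.le)
  · refine EReal.ge_of_forall_gt_iff_ge.1 fun t ht => ?_
    refine le_iInf₂ fun x hx => EReal.coe_le_coe_iff.2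
      (neg_le_neg_iff.1 (h' K hK (-t) (fun y hy => neg_le_neg ?_) x hx))
    exact EReal.coe_le_coe_iff.1
      (ht.le.trans (iInf₂_le (f := fun x (_ : x ∈ frontier K) => (u x : EReal)) y hy))

/-- Each component of an `∞`-continuum that meets a compact set meets its boundary. -/
theorem IsInfContinuum.exists_mem_frontier {X : Type*} [TopologicalSpace X] [T2Space X]
    {C K : Set X} (hC : IsInfContinuum C) (hK : IsCompact K) {x : X} (hxC : x ∈ C) (hxK : x ∈ K) :
    ∃ y ∈ connectedComponentIn C x, y ∈ frontier K := by
  have hxE : x ∈ connectedComponentIn C x := mem_connectedComponentIn hxC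
  have hclosed : IsClosed (connectedComponentIn C x) :=
    closure_subset_iff_isClosed.1 <|
      isPreconnected_connectedComponentIn.closure.subset_connectedComponentIn
        (subset_closure hxE)
        (closure_minimal (connectedComponentIn_subset C x) hC.1)
  have hnot : ¬ connectedComponentIn C x ⊆ K := fun hsub =>
    hC.2 x hxC (hK.of_isClosed_subset hclosed hsub)
  obtain ⟨z, hzE, hzK⟩ := Set.not_subset.1 hnot
  by_contra! hempty
  have hint : ∀ y ∈ connectedComponentIn C x, y ∈ K → y ∈ interior K := fun y hyE hyK => by
    by_contra hy
    exact hempty y hyE ⟨subset_closure hyK, hy⟩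
  obtain ⟨y, -, hyi, hyc⟩ := isPreconnected_connectedComponentIn (interior K) Kᶜ
    isOpen_interior hK.isClosed.isOpen_compl
    (fun y hyE => (em (y ∈ K)).imp (hint y hyE) id) ⟨x, hxE, hint x hxE hxK⟩ ⟨z, hzE, hzK⟩
  exact hyc (interior_subset hyi)

/-- The maximum principle extends across an `∞`-continuum on which a continuous function takes
finitely many values. -/
theorem HasMaxPrinciple.of_compl_infContinuum {X : Type*} [TopologicalSpace X] [T2Space X]
    {C : Set X} {u : X → ℝ} (hC : IsInfContinuum C) (hu : Continuous u)
    (hfin : (u '' C).Finite) (h : HasMaxPrinciple (fun a : (Cᶜ : Set X) => u a)) :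
    HasMaxPrinciple u := by
  intro K hK t ht x hx
  by_contra! hlt
  obtain ⟨s, hts, hsx⟩ := exists_between hlt
  set L : Set X := K ∩ {z | s ≤ u z} with hL
  have hLK : IsCompact L := hK.inter_right (isClosed_le continuous_const hu)
  have hLC : L ⊆ Cᶜ := by
    rintro z ⟨hzK, hzs⟩ hzC
    obtain ⟨y, hyE, hyK⟩ := hC.exists_mem_frontier hK hzC hzK
    have hconst : u y = u z :=
      hfin.countable.isTotallyDisconnected (u '' connectedComponentIn C z)
        (Set.image_mono (connectedComponentIn_subset C z))
        (isPreconnected_connectedComponentIn.image u hu.continuousOn)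
        (Set.mem_image_of_mem u hyE) (Set.mem_image_of_mem u (mem_connectedComponentIn hzC))
    have := ht y hyK
    have : s ≤ u z := hzs
    linarith
  have hLint : ∀ z ∈ L, s < u z → z ∈ interior L := by
    rintro z ⟨hzK, hzs⟩ hz
    have hzint : z ∈ interior K := by
      by_contra hzint
      have := ht z ⟨subset_closure hzK, hzint⟩
      linarith
    rw [hL, interior_inter]
    exact ⟨hzint, interior_mono (fun w (hw : s < u w) => hw.le)
      ((isOpen_lt continuous_const hu).interior_eq.symm ▸ hz)⟩
  have hL' : IsCompact ((↑) ⁻¹' L : Set (Cᶜ : Set X)) :=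
    Topology.IsInducing.subtypeVal.isCompact_preimage' hLK (by rwa [Subtype.range_coe])
  refine hsx.not_ge (h _ hL' s (fun y hy => ?_) ⟨x, hLC ⟨hx, hsx.le⟩⟩ ⟨hx, hsx.le⟩)
  by_contra! hys
  have hyL : (y : X) ∈ L := hL'.isClosed.frontier_subset hy
  exact hy.2 (preimage_interior_subset_interior_preimage continuous_subtype_val
    (hLint y hyL hys))

/-- Ferrand's lemma: if `u` is a bounded continuous function on a Hausdorff space, monotone
outside an `∞`-continuum `C`, and `C` is contained in the set where `u` attains its supremum
or its infimum, then `u` is monotone on all of `X`. -/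
theorem isMonotoneFn_of_isMonotoneFnOn_compl_infContinuum
    {X : Type*} [TopologicalSpace X] [T2Space X] {C : Set X} {u : X → ℝ}
    (hC : IsInfContinuum C) (hu : Continuous u) (hb : ∃ M : ℝ, ∀ x, |u x| ≤ M)
    (hmon : IsMonotoneFnOn u Cᶜ)
    (hCval : C ⊆ {x | u x = sSup (Set.range u)} ∪ {x | u x = sInf (Set.range u)}) :
    IsMonotoneFn u := by
  have hfin : (u '' C).Finite := by
    refine (Set.toFinite {sSup (Set.range u), sInf (Set.range u)}).subset ?_
    rintro _ ⟨x, hx, rfl⟩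
    exact hCval hx
  have hfin' : ((fun x => -u x) '' C).Finite := by
    simpa only [Set.image_image] using hfin.image Neg.neg
  exact isMonotoneFn_of_hasMaxPrinciple (.of_compl_infContinuum hC hu hfin hmon.hasMaxPrinciple)
    (.of_compl_infContinuum hC hu.neg hfin' hmon.hasMaxPrinciple_neg)
end

section
/- Let X be a Hausdorff topological space, let K ⊆ X be a compact connected subset, and let u : X → ℝ be a bounded continuous function such that K ⊆ {x ∈ X : u(x) = sup_X u} or K ⊆ {x ∈ X : u(x) = inf_X u}. If u is monotone on X ∖ K, then for every x ∈ K the function u is monotone on X ∖ {x}. -/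
/-- The maximum principle for compact subsets of `A`: every value of `u` on a compact set
`C ⊆ A` is dominated by a value of `u` on the frontier of `C`. -/
def HasMaxPrincipleOn {X : Type*} [TopologicalSpace X] (u : X → ℝ) (A : Set X) : Prop :=
  ∀ C : Set X, IsCompact C → C ⊆ A → ∀ c ∈ C, ∃ y ∈ frontier C, u c ≤ u y

theorem IsCompact.exists_mem_le_of_coe_le_iSup {Z : Type*} [TopologicalSpace Z] {F : Set Z}
    {u : Z → ℝ} (hF : IsCompact F) (hu : Continuous u) {r : ℝ}
    (h : (r : EReal) ≤ ⨆ x ∈ F, (u x : EReal)) : ∃ y ∈ F, r ≤ u y := by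
  rcases F.eq_empty_or_nonempty with rfl | hne
  · simp at h
  · obtain ⟨y, hy, hmax⟩ := hF.exists_isMaxOn hne hu.continuousOn
    refine ⟨y, hy, EReal.coe_le_coe_iff.1 (h.trans (iSup₂_le fun z hz => ?_))⟩
    exact EReal.coe_le_coe_iff.2 (hmax hz)

theorem IsCompact.exists_mem_le_of_iInf_le_coe {Z : Type*} [TopologicalSpace Z] {F : Set Z}
    {u : Z → ℝ} (hF : IsCompact F) (hu : Continuous u) {r : ℝ}
    (h : (⨅ x ∈ F, (u x : EReal)) ≤ r) : ∃ y ∈ F, u y ≤ r := by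
  rcases F.eq_empty_or_nonempty with rfl | hne
  · simp at h
  · obtain ⟨y, hy, hmin⟩ := hF.exists_isMinOn hne hu.continuousOn
    refine ⟨y, hy, EReal.coe_le_coe_iff.1 ((le_iInf₂ fun z hz => ?_).trans h)⟩
    exact EReal.coe_le_coe_iff.2 (hmin hz)

theorem isMonotoneFn_iff {Z : Type*} [TopologicalSpace Z] [T2Space Z] {u : Z → ℝ}
    (hu : Continuous u) :
    IsMonotoneFn u ↔ ∀ C : Set Z, IsCompact C → ∀ c ∈ C,
      (∃ y ∈ frontier C, u c ≤ u y) ∧ (∃ y ∈ frontier C, u y ≤ u c) := by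
  constructor
  · intro h C hC c hc
    have hF : IsCompact (frontier C) :=
      hC.of_isClosed_subset isClosed_frontier hC.isClosed.frontier_subset
    refine ⟨hF.exists_mem_le_of_coe_le_iSup hu ?_, hF.exists_mem_le_of_iInf_le_coe hu ?_⟩
    · rw [(h C hC).1]
      exact le_iSup₂ (f := fun x (_ : x ∈ C) => (u x : EReal)) c hc
    · rw [(h C hC).2]
      exact iInf₂_le (f := fun x (_ : x ∈ C) => (u x : EReal)) c hc
  · intro h C hC
    have hsub : frontier C ⊆ C := hC.isClosed.frontier_subset
    refine ⟨le_antisymm (biSup_mono hsub) (iSup₂_le fun c hc => ?_),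
      le_antisymm (le_iInf₂ fun c hc => ?_) (biInf_mono hsub)⟩
    · obtain ⟨y, hy, hle⟩ := (h C hC c hc).1
      exact (EReal.coe_le_coe_iff.2 hle).trans
        (le_iSup₂ (f := fun x (_ : x ∈ frontier C) => (u x : EReal)) y hy)
    · obtain ⟨y, hy, hle⟩ := (h C hC c hc).2
      exact (iInf₂_le (f := fun x (_ : x ∈ frontier C) => (u x : EReal)) y hy).trans
        (EReal.coe_le_coe_iff.2 hle)

theorem isMonotoneFnOn_iff {X : Type*} [TopologicalSpace X] [T2Space X] {A : Set X} {u : X → ℝ}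
    (hu : Continuous u) (hA : IsOpen A) :
    IsMonotoneFnOn u A ↔ HasMaxPrincipleOn u A ∧ HasMaxPrincipleOn (-u) A := by
  have hfr (C : Set X) : Subtype.val ⁻¹' frontier C = frontier (Subtype.val ⁻¹' C : Set A) :=
    hA.isOpenMap_subtype_val.preimage_frontier_eq_frontier_preimage continuous_subtype_val C
  refine (isMonotoneFn_iff (hu.comp continuous_subtype_val)).trans ?_
  constructor
  · intro h
    have key (C : Set X) (hC : IsCompact C) (hCA : C ⊆ A) (c : X) (hc : c ∈ C) :=
      h (Subtype.val ⁻¹' C) (Topology.IsInducing.subtypeVal.isCompact_preimage'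
        hC (by simpa using hCA)) ⟨c, hCA hc⟩ hc
    simp only [← hfr] at key
    refine ⟨fun C hC hCA c hc => ?_, fun C hC hCA c hc => ?_⟩
    · obtain ⟨y, hy, hle⟩ := (key C hC hCA c hc).1
      exact ⟨y, hy, hle⟩
    · obtain ⟨y, hy, hle⟩ := (key C hC hCA c hc).2
      exact ⟨y, hy, neg_le_neg hle⟩
  · rintro ⟨hmax, hmin⟩ C hC c hc
    have hC' : IsCompact (Subtype.val '' C) := hC.image continuous_subtype_val
    have hCA : Subtype.val '' C ⊆ A := Subtype.coe_image_subset A C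
    have hsub : frontier (Subtype.val '' C) ⊆ A := hC'.isClosed.frontier_subset.trans hCA
    have hfrC := hfr (Subtype.val '' C)
    rw [Set.preimage_image_eq _ Subtype.val_injective] at hfrC
    rw [← hfrC]
    constructor
    · obtain ⟨y, hy, hle⟩ := hmax _ hC' hCA c (Set.mem_image_of_mem _ hc)
      exact ⟨⟨y, hsub hy⟩, hy, hle⟩
    · obtain ⟨y, hy, hle⟩ := hmin _ hC' hCA c (Set.mem_image_of_mem _ hc)
      exact ⟨⟨y, hsub hy⟩, hy, neg_le_neg_iff.1 hle⟩

/-- A set that misses a point of the connected set `K`, but meets `K`, has a frontier point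
in `K`. -/
theorem IsConnected.inter_frontier_nonempty_of_notMem {X : Type*} [TopologicalSpace X]
    {K C : Set X} (hK : IsConnected K) {x : X} (hx : x ∈ K) (hxC : x ∉ C)
    (hne : (K ∩ C).Nonempty) : (K ∩ frontier C).Nonempty := by
  by_contra hemp
  have hcover : K ⊆ interior C ∪ (closure C)ᶜ := fun z hz =>
    or_iff_not_imp_left.2 fun hzi hzc => hemp ⟨z, hz, hzc, hzi⟩
  obtain ⟨c, hcK, hcC⟩ := hne
  have hci : c ∈ interior C :=
    (hcover hcK).resolve_right fun hcc => hcc (subset_closure hcC)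
  have hxc : x ∈ (closure C)ᶜ :=
    (hcover hx).resolve_left fun hxi => hxC (interior_subset hxi)
  obtain ⟨z, -, hzi, hzc⟩ := hK.isPreconnected _ _ isOpen_interior isClosed_closure.isOpen_compl
    hcover ⟨c, hcK, hci⟩ ⟨x, hx, hxc⟩
  exact hzc (subset_closure (interior_subset hzi))

theorem HasMaxPrincipleOn.compl_singleton {X : Type*} [TopologicalSpace X]
    {K : Set X} {u : X → ℝ} {S : ℝ} (hK : IsConnected K) (hle : ∀ z, u z ≤ S)
    (hKS : ∀ z ∈ K, u z = S) (h : HasMaxPrincipleOn u Kᶜ) {x : X} (hx : x ∈ K) :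
    HasMaxPrincipleOn u {x}ᶜ := by
  intro C hC hCx c hc
  rcases (K ∩ C).eq_empty_or_nonempty with he | hne
  · exact h C hC (fun z hz hzK => (he.subset ⟨hzK, hz⟩).elim) c hc
  · obtain ⟨y, hyK, hy⟩ :=
      hK.inter_frontier_nonempty_of_notMem hx (fun hxC => hCx hxC rfl) hne
    exact ⟨y, hy, (hle c).trans (hKS y hyK).ge⟩

theorem HasMaxPrincipleOn.neg_compl_singleton {X : Type*} [TopologicalSpace X] [T2Space X]
    {K : Set X} {u : X → ℝ} {S : ℝ} (hu : Continuous u) (hK : IsConnected K)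
    (hle : ∀ z, u z ≤ S) (hKS : ∀ z ∈ K, u z = S) (h : HasMaxPrincipleOn (-u) Kᶜ) {x : X}
    (hx : x ∈ K) : HasMaxPrincipleOn (-u) {x}ᶜ := by
  intro C hC hCx c hc
  rcases (K ∩ C).eq_empty_or_nonempty with he | hne
  · exact h C hC (fun z hz hzK => (he.subset ⟨hzK, hz⟩).elim) c hc
  have hFne : (frontier C).Nonempty :=
    (hK.inter_frontier_nonempty_of_notMem hx (fun hxC => hCx hxC rfl) hne).mono
      Set.inter_subset_right
  have hF : IsCompact (frontier C) :=
    hC.of_isClosed_subset isClosed_frontier hC.isClosed.frontier_subset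
  obtain ⟨m, hm, hmin⟩ := hF.exists_isMinOn hFne hu.continuousOn
  by_contra! hlt
  obtain ⟨t, hct, htm⟩ := exists_between (neg_lt_neg_iff.1 (hlt m hm))
  have hclosed : IsClosed {z | u z ≤ t} := isClosed_le hu continuous_const
  have hCK : C ∩ {z | u z ≤ t} ⊆ Kᶜ := fun z hz hzK =>
    (htm.trans_le ((hle m).trans (hKS z hzK).ge)).not_ge hz.2
  obtain ⟨y, hy, hyc⟩ := h _ (hC.inter_right hclosed) hCK c ⟨hc, hct.le⟩
  rcases frontier_inter_subset _ _ hy with ⟨hyC, hyt⟩ | ⟨-, hyt⟩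
  · exact (htm.trans_le (hmin hyC)).not_ge (hclosed.closure_subset hyt)
  · have hyt' : u y = t := frontier_le_subset_eq hu continuous_const hyt
    exact (hct.trans_le hyt'.ge).not_ge (neg_le_neg_iff.1 hyc)

/-- Ferrand's lemma: if `K` is a compact connected set in a Hausdorff space on which a bounded
continuous function `u` attains its supremum (or its infimum), and `u` is monotone on `X \ K`,
then `u` is monotone on `X \ {x}` for every `x ∈ K`. -/
theorem isMonotoneFnOn_compl_singleton_of_compl_continuum
    {X : Type*} [TopologicalSpace X] [T2Space X] {K : Set X} {u : X → ℝ}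
    (hK : IsCompact K) (hKconn : IsConnected K)
    (hu : Continuous u) (hb : ∃ M : ℝ, ∀ x, |u x| ≤ M)
    (hKval : K ⊆ {x | u x = sSup (Set.range u)} ∨ K ⊆ {x | u x = sInf (Set.range u)})
    (hmon : IsMonotoneFnOn u Kᶜ) :
    ∀ x ∈ K, IsMonotoneFnOn u {x}ᶜ := by
  intro x hx
  obtain ⟨M, hM⟩ := hb
  obtain ⟨hmax, hmin⟩ := (isMonotoneFnOn_iff hu hK.isClosed.isOpen_compl).1 hmon
  rw [isMonotoneFnOn_iff hu isOpen_compl_singleton]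
  rcases hKval with hS | hI
  · have hle (z : X) : u z ≤ sSup (Set.range u) :=
      le_csSup ⟨M, Set.forall_mem_range.2 fun z => (abs_le.1 (hM z)).2⟩ ⟨z, rfl⟩
    exact ⟨hmax.compl_singleton hKconn hle (fun z hz => hS hz) hx,
      hmin.neg_compl_singleton hu hKconn hle (fun z hz => hS hz) hx⟩
  · have hle (z : X) : (-u) z ≤ -sInf (Set.range u) := neg_le_neg <|
      csInf_le ⟨-M, Set.forall_mem_range.2 fun z => (abs_le.1 (hM z)).1⟩ ⟨z, rfl⟩
    have hval : ∀ z ∈ K, (-u) z = -sInf (Set.range u) := fun z hz => congrArg Neg.neg (hI hz)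
    rw [← neg_neg u] at hmax
    refine ⟨?_, hmin.compl_singleton hKconn hle hval hx⟩
    simpa only [neg_neg] using hmax.neg_compl_singleton hu.neg hKconn hle hval hx
end

section
/- Let (X, d_X, μ_X) and (Y, d_Y, μ_Y) be separable metric spaces equipped with Borel measures, and assume that for every r > 0 the volume functions satisfy 0 < inf_{x∈X} μ_X(B(x,r)), sup_{x∈X} μ_X(B(x,r)) < ∞, and similarly 0 < inf_{y∈Y} μ_Y(B(y,r)) and sup_{y∈Y} μ_Y(B(y,r)) < ∞. Suppose there exists a quasi-isometry f : X → Y, and let N ∈ [1,∞). Then X has degree of large-scale growth at most N if and only if Y has degree of large-scale growth at most N. -/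
open Metric MeasureTheory

/-- For `L ≥ 1` and `C ≥ 0`, a map between metric spaces is an `(L,C)`-quasi-isometry if it
distorts distances by at most the affine factors `(L, C)` and its image is `C`-dense. -/
def IsQuasiIsometry {X Y : Type*} [MetricSpace X] [MetricSpace Y]
    (L C : ℝ) (f : X → Y) : Prop :=
  (∀ x₁ x₂ : X,
      (1 / L) * dist x₁ x₂ - C ≤ dist (f x₁) (f x₂) ∧
      dist (f x₁) (f x₂) ≤ L * dist x₁ x₂ + C) ∧
  ∀ y : Y, ∃ x : X, dist (f x) y ≤ C

/-- A metric measure space has degree of large-scale growth at most `N` if there is a constant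
`C` with `μ (B(x,R)) ≤ C * R ^ N` for all `x` and all `R > 1`. -/
def GrowthDegreeAtMost {X : Type*} [MetricSpace X] [MeasurableSpace X]
    (μ : Measure X) (N : ℝ) : Prop :=
  ∃ C : ℝ, ∀ x : X, ∀ R : ℝ, 1 < R → μ (ball x R) ≤ ENNReal.ofReal (C * R ^ N)

/-- If the cardinalities of the finite `s`-separated subsets of `S` are bounded, then `S` is covered
by the `s`-balls around some finite `s`-separated subset. -/
lemma exists_separated_finset_cover {Y : Type*} [MetricSpace Y] {s : ℝ} (hs : 0 < s) (S : Set Y)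
    (B : ℕ)
    (hB : ∀ T : Finset Y, (T : Set Y) ⊆ S → (T : Set Y).Pairwise (fun a b => s ≤ dist a b) →
      T.card ≤ B) :
    ∃ T : Finset Y, (T : Set Y) ⊆ S ∧ (T : Set Y).Pairwise (fun a b => s ≤ dist a b) ∧
      S ⊆ ⋃ z ∈ T, ball z s := by
  classical
  let P : ℕ → Prop := fun n => ∃ T : Finset Y, (T : Set Y) ⊆ S ∧
    (T : Set Y).Pairwise (fun a b => s ≤ dist a b) ∧ T.card = n
  have h0 : P 0 := ⟨∅, by simp, by simp, rfl⟩
  obtain ⟨T, hTS, hTp, hTc⟩ : P (Nat.findGreatest P B) := Nat.findGreatest_spec (Nat.zero_le B) h0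
  refine ⟨T, hTS, hTp, fun y hy => ?_⟩
  by_contra hcov
  simp only [Set.mem_iUnion, mem_ball, not_exists, not_lt] at hcov
  have hyT : y ∉ T := fun h => by
    have := hcov y h
    rw [dist_self] at this
    linarith
  have hsub : ((insert y T : Finset Y) : Set Y) ⊆ S := by
    rw [Finset.coe_insert]
    exact Set.insert_subset hy hTS
  have hpair : ((insert y T : Finset Y) : Set Y).Pairwise (fun a b => s ≤ dist a b) := by
    rw [Finset.coe_insert]
    refine hTp.insert fun b hb _ => ⟨hcov b hb, ?_⟩
    rw [dist_comm]
    exact hcov b hb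
  have hcard : (insert y T).card = T.card + 1 := Finset.card_insert_of_notMem hyT
  have hle : (insert y T).card ≤ Nat.findGreatest P B :=
    Nat.le_findGreatest (hB _ hsub hpair) ⟨_, hsub, hpair, rfl⟩
  omega

/-- If `g` maps `T` to a `2`-separated family inside `ball x ρ`, then `ball x (ρ + 1)` has measure
at least `T.card` times any lower bound for the measures of unit balls. -/
lemma card_mul_le_measure_ball {X Y : Type*} [MetricSpace X] [MeasurableSpace X] [BorelSpace X]
    (μ : Measure X) {m : ENNReal} (hm : ∀ x : X, m ≤ μ (ball x 1)) (g : Y → X) (T : Finset Y)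
    (hsep : (T : Set Y).Pairwise (fun a b => 2 ≤ dist (g a) (g b))) (x : X) (ρ : ℝ)
    (hT : ∀ z ∈ T, dist (g z) x ≤ ρ) :
    (T.card : ENNReal) * m ≤ μ (ball x (ρ + 1)) := by
  calc (T.card : ENNReal) * m = ∑ _z ∈ T, m := by simp
    _ ≤ ∑ z ∈ T, μ (ball (g z) 1) := Finset.sum_le_sum fun z _ => hm _
    _ = μ (⋃ z ∈ T, ball (g z) 1) := by
        refine (measure_biUnion_finset ?_ fun _ _ => measurableSet_ball).symm
        intro a ha b hb hab
        exact ball_disjoint_ball (by linarith [hsep ha hb hab])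
    _ ≤ μ (ball x (ρ + 1)) := by
        refine measure_mono (Set.iUnion₂_subset fun z hz => ball_subset_ball' ?_)
        linarith [hT z hz]

/-- Large-scale growth bounds pull back along quasi-isometric embeddings. -/
lemma GrowthDegreeAtMost.of_quasiIsometricEmbedding {X Y : Type*} [MetricSpace X] [MetricSpace Y]
    [MeasurableSpace X] [MeasurableSpace Y] [BorelSpace X]
    {μX : Measure X} {μY : Measure Y}
    (hX : ∀ r : ℝ, 0 < r → (0 < ⨅ x : X, μX (ball x r)) ∧ (⨆ x : X, μX (ball x r)) < ⊤)
    (hY : ∀ r : ℝ, 0 < r → (⨆ y : Y, μY (ball y r)) < ⊤)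
    {A : ℝ} (hA : 1 ≤ A) (g : Y → X)
    (hg_upper : ∀ a b, dist (g a) (g b) ≤ A * dist a b + A)
    (hg_lower : ∀ a b, dist a b ≤ A * dist (g a) (g b) + A)
    {N : ℝ} (hN : 0 ≤ N) (h : GrowthDegreeAtMost μX N) : GrowthDegreeAtMost μY N := by
  obtain ⟨C, hC⟩ := h
  have hs : 0 < 3 * A := by linarith
  set m := ⨅ x : X, μX (ball x 1)
  set M := ⨆ y : Y, μY (ball y (3 * A))
  have hm0 : 0 < m := (hX 1 one_pos).1
  have hMtop : M < ⊤ := hY _ hs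
  refine ⟨(M / m).toReal * (|C| * (2 * A + 1) ^ N), fun y R hR => ?_⟩
  have hmtop : m ≠ ⊤ :=
    ((iInf_le _ (g y)).trans (le_iSup (fun x => μX (ball x 1)) (g y))).trans_lt
      (hX 1 one_pos).2 |>.ne
  have hρ : 1 < A * R + A + 1 := by nlinarith
  set V := μX (ball (g y) (A * R + A + 1))
  have hVtop : V < ⊤ :=
    (le_iSup (fun x => μX (ball x (A * R + A + 1))) (g y)).trans_lt
      (hX _ (by linarith)).2
  have hcard : ∀ T : Finset Y, (T : Set Y) ⊆ ball y R →
      (T : Set Y).Pairwise (fun a b => 3 * A ≤ dist a b) → (T.card : ENNReal) ≤ V / m := by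
    intro T hT hsep
    rw [ENNReal.le_div_iff_mul_le (Or.inl hm0.ne') (Or.inl hmtop)]
    refine card_mul_le_measure_ball μX (fun x => iInf_le _ x) g T ?_ _ _ ?_
    · intro a ha b hb hab
      have h1 : 3 * A ≤ dist a b := hsep ha hb hab
      have h2 := hg_lower a b
      by_contra! hlt
      nlinarith
    · intro z hz
      have h1 : dist z y < R := hT hz
      nlinarith [hg_upper z y]
  have hVm : V / m ≠ ⊤ := ENNReal.div_ne_top hVtop.ne hm0.ne'
  obtain ⟨B, hB⟩ := ENNReal.exists_nat_gt hVm
  obtain ⟨T, hTS, hTp, hcov⟩ := exists_separated_finset_cover hs (ball y R) B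
    fun T hT hsep => by exact_mod_cast ((hcard T hT hsep).trans hB.le)
  have hVle : V ≤ ENNReal.ofReal (|C| * (2 * A + 1) ^ N * R ^ N) := by
    refine (hC _ _ hρ).trans (ENNReal.ofReal_le_ofReal ?_)
    rw [mul_assoc, ← Real.mul_rpow (by linarith) (by linarith)]
    refine mul_le_mul (le_abs_self C) ?_ (by positivity) (abs_nonneg C)
    exact Real.rpow_le_rpow (by linarith) (by nlinarith) hN
  calc μY (ball y R) ≤ μY (⋃ z ∈ T, ball z (3 * A)) := measure_mono hcov
    _ ≤ ∑ z ∈ T, μY (ball z (3 * A)) := measure_biUnion_finset_le _ _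
    _ ≤ ∑ _z ∈ T, M := Finset.sum_le_sum fun z _ => le_iSup (fun y => μY (ball y (3 * A))) z
    _ = T.card * M := by simp
    _ ≤ V / m * M := by gcongr; exact hcard T hTS hTp
    _ = M / m * V := by simp only [div_eq_mul_inv]; ring
    _ ≤ M / m * ENNReal.ofReal (|C| * (2 * A + 1) ^ N * R ^ N) := by gcongr
    _ = ENNReal.ofReal ((M / m).toReal * (|C| * (2 * A + 1) ^ N) * R ^ N) := by
        rw [mul_assoc (M / m).toReal, ENNReal.ofReal_mul ENNReal.toReal_nonneg,
          ENNReal.ofReal_toReal (ENNReal.div_ne_top hMtop.ne hm0.ne')]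

/-- Quasi-isometry invariance of the degree of large-scale growth, for separable metric
measure spaces whose volume functions take values in `(0, ∞)`. -/
theorem growthDegreeAtMost_quasiIsometry_invariant
    {X Y : Type*} [MetricSpace X] [MetricSpace Y]
    [TopologicalSpace.SeparableSpace X] [TopologicalSpace.SeparableSpace Y]
    [MeasurableSpace X] [MeasurableSpace Y] [BorelSpace X] [BorelSpace Y]
    (μX : Measure X) (μY : Measure Y)
    (hX : ∀ r : ℝ, 0 < r → (0 < ⨅ x : X, μX (ball x r)) ∧ (⨆ x : X, μX (ball x r)) < ⊤)
    (hY : ∀ r : ℝ, 0 < r → (0 < ⨅ y : Y, μY (ball y r)) ∧ (⨆ y : Y, μY (ball y r)) < ⊤)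
    (hqi : ∃ (L C : ℝ) (f : X → Y), 1 ≤ L ∧ 0 ≤ C ∧ IsQuasiIsometry L C f)
    (N : ℝ) (hN : 1 ≤ N) :
    GrowthDegreeAtMost μX N ↔ GrowthDegreeAtMost μY N := by
  obtain ⟨L, C, f, hL, hC, hf, hdense⟩ := hqi
  have hL0 : 0 < L := by linarith
  have hLC : C ≤ L * C := le_mul_of_one_le_left hC hL
  have hLC0 : 0 ≤ L * C := by positivity
  have hupper : ∀ a b, dist (f a) (f b) ≤ L * dist a b + C := fun a b => (hf a b).2
  have hlower : ∀ a b, dist a b ≤ L * dist (f a) (f b) + L * C := fun a b => by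
    have h := mul_le_mul_of_nonneg_left (hf a b).1 hL0.le
    have h' : L * (1 / L * dist a b - C) = dist a b - L * C := by field_simp
    linarith
  have hA : 1 ≤ L + 3 * (L * C) := by linarith
  have hmono : ∀ d : ℝ, 0 ≤ d → L * d ≤ (L + 3 * (L * C)) * d := fun d hd =>
    mul_le_mul_of_nonneg_right (by linarith) hd
  constructor
  · choose g hg using hdense
    refine GrowthDegreeAtMost.of_quasiIsometricEmbedding hX (fun r hr => (hY r hr).2) hA g
      (fun a b => ?_) (fun a b => ?_) (by linarith)
    · have h1 : dist (f (g a)) (f (g b)) ≤ dist a b + 2 * C := by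
        have := dist_triangle4 (f (g a)) a b (f (g b))
        have hb := hg b
        rw [dist_comm] at hb
        linarith [hg a]
      have h2 := mul_le_mul_of_nonneg_left h1 hL0.le
      linarith [hlower (g a) (g b), hmono _ (dist_nonneg (x := a) (y := b))]
    · have h1 : dist a b ≤ dist (f (g a)) (f (g b)) + 2 * C := by
        have := dist_triangle4 a (f (g a)) (f (g b)) b
        have ha := hg a
        rw [dist_comm] at ha
        linarith [hg b]
      linarith [hupper (g a) (g b), hmono _ (dist_nonneg (x := g a) (y := g b))]
  · refine GrowthDegreeAtMost.of_quasiIsometricEmbedding hY (fun r hr => (hX r hr).2) hA f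
      (fun a b => ?_) (fun a b => ?_) (by linarith)
    · linarith [hupper a b, hmono _ (dist_nonneg (x := a) (y := b))]
    · linarith [hlower a b, hmono _ (dist_nonneg (x := f a) (y := f b))]
end

section
/- Let (X,d) be a metric space, K ≥ 0, and let ζ : ℤ → X be a K-quasi-straight sequence. Let m, n ∈ ℤ with m ≤ n. Then for all i, j ∈ ℤ with i ≤ m and n ≤ j, one has d(ζ_i, ζ_j) ≥ (1/(1+K)²)·d(ζ_m, ζ_n) − K(K+2)/(1+K)². -/
/-- For `K ≥ 0`, a bi-infinite sequence `ζ : ℤ → X` in a metric space is a `K`-quasi-straight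
sequence if `ζ(ℤ≤0)` and `ζ(ℤ≥0)` are unbounded, consecutive points are at distance at most
`1 + K`, and the sequence is quantitatively almost aligned. -/
def IsQuasiStraightSeq {X : Type*} [MetricSpace X] (K : ℝ) (ζ : ℤ → X) : Prop :=
  ¬ Bornology.IsBounded (ζ '' {k : ℤ | k ≤ 0}) ∧
  ¬ Bornology.IsBounded (ζ '' {k : ℤ | 0 ≤ k}) ∧
  (∀ k : ℤ, dist (ζ k) (ζ (k + 1)) ≤ 1 + K) ∧
  ∀ i j k : ℤ, i ≤ j → j ≤ k →
    dist (ζ i) (ζ j) + dist (ζ j) (ζ k) - dist (ζ i) (ζ k) ≤ K * dist (ζ i) (ζ k) + K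

/-- Along a `K`-quasi-straight sequence, the distance between `ζ i` and `ζ j`, for `i ≤ m` and
`n ≤ j`, is bounded from below in terms of the distance between `ζ m` and `ζ n`. -/
theorem quasiStraightSeq_dist_lower_bound
    {X : Type*} [MetricSpace X] (K : ℝ) (hK : 0 ≤ K)
    (ζ : ℤ → X) (hζ : IsQuasiStraightSeq K ζ)
    (m n : ℤ) (hmn : m ≤ n) :
    ∀ i j : ℤ, i ≤ m → n ≤ j →
      dist (ζ i) (ζ j) ≥
        (1 / (1 + K) ^ 2) * dist (ζ m) (ζ n) - K * (K + 2) / (1 + K) ^ 2 := by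
  intro i j hi hj
  obtain ⟨-, -, -, h⟩ := hζ
  have hin : dist (ζ m) (ζ n) ≤ (1 + K) * dist (ζ i) (ζ n) + K := by
    linarith [h i m n hi hmn, dist_nonneg (x := ζ i) (y := ζ m)]
  have hij : dist (ζ i) (ζ n) ≤ (1 + K) * dist (ζ i) (ζ j) + K := by
    linarith [h i n j (hi.trans hmn) hj, dist_nonneg (x := ζ n) (y := ζ j)]
  have hmul := mul_le_mul_of_nonneg_left hij (by linarith : 0 ≤ 1 + K)
  rw [ge_iff_le, one_div_mul_eq_div, ← sub_div, div_le_iff₀ (by positivity)]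
  linarith
end

section
/- Consider the snowflaked Euclidean line, i.e., ℝ equipped with the metric d(x,y) := √|x − y|. Then the sequence ζ : ℤ → ℝ given by ζ_k = k is a (√2 − 1)-quasi-straight sequence in (ℝ, d). -/
/-- The snowflaked Euclidean line: `ℝ` equipped with the metric `d(x,y) = √|x - y|`. -/
structure SnowflakeLine where
  /-- the underlying real number -/
  val : ℝ

noncomputable instance : MetricSpace SnowflakeLine where
  dist x y := Real.sqrt |x.val - y.val|
  dist_self x := by simp
  dist_comm x y := by simp [abs_sub_comm]
  dist_triangle x y z := by
    have habs : |x.val - z.val| ≤ |x.val - y.val| + |y.val - z.val| := abs_sub_le _ _ _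
    have h1 : Real.sqrt |x.val - z.val| ≤ Real.sqrt (|x.val - y.val| + |y.val - z.val|) :=
      Real.sqrt_le_sqrt habs
    have ha : (0:ℝ) ≤ |x.val - y.val| := abs_nonneg _
    have hb : (0:ℝ) ≤ |y.val - z.val| := abs_nonneg _
    have hsa := Real.sqrt_nonneg |x.val - y.val|
    have hsb := Real.sqrt_nonneg |y.val - z.val|
    have hsc := Real.sqrt_nonneg (|x.val - y.val| + |y.val - z.val|)
    have hsa2 := Real.sq_sqrt ha
    have hsb2 := Real.sq_sqrt hb
    have hsc2 := Real.sq_sqrt (by positivity : (0:ℝ) ≤ |x.val - y.val| + |y.val - z.val|)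
    have h2 : Real.sqrt (|x.val - y.val| + |y.val - z.val|) ≤
        Real.sqrt |x.val - y.val| + Real.sqrt |y.val - z.val| := by
      nlinarith [mul_nonneg hsa hsb]
    exact le_trans h1 h2
  eq_of_dist_eq_zero := by
    intro x y h
    have h0 : |x.val - y.val| = 0 := by
      have := Real.sqrt_eq_zero (abs_nonneg (x.val - y.val)) |>.mp h
      exact this
    have : x.val = y.val := by rwa [abs_eq_zero, sub_eq_zero] at h0
    cases x; cases y; simpa using this

theorem SnowflakeLine.dist_eq (x y : SnowflakeLine) : dist x y = Real.sqrt |x.val - y.val| := rfl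

theorem SnowflakeLine.dist_mk_of_le {x y : ℝ} (h : x ≤ y) :
    dist (SnowflakeLine.mk x) (SnowflakeLine.mk y) = Real.sqrt (y - x) := by
  rw [SnowflakeLine.dist_eq, abs_sub_comm, abs_of_nonneg (sub_nonneg.mpr h)]

/-- A bounded subset of the snowflaked line is bounded in the Euclidean sense. -/
theorem SnowflakeLine.exists_abs_sub_le {s : Set SnowflakeLine} (hs : Bornology.IsBounded s) :
    ∃ C : ℝ, ∀ x ∈ s, ∀ y ∈ s, |x.val - y.val| ≤ C := by
  obtain ⟨C, hC⟩ := Metric.isBounded_iff.mp hs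
  refine ⟨C ^ 2, fun x hx y hy => ?_⟩
  have h := hC hx hy
  rw [SnowflakeLine.dist_eq] at h
  exact (Real.sqrt_le_iff.mp h).2

theorem Real.sqrt_add_sqrt_le {a b : ℝ} (ha : 0 ≤ a) (hb : 0 ≤ b) :
    Real.sqrt a + Real.sqrt b ≤ Real.sqrt 2 * Real.sqrt (a + b) := by
  rw [← Real.sqrt_mul zero_le_two]
  apply Real.le_sqrt_of_sq_le
  nlinarith [sq_nonneg (Real.sqrt a - Real.sqrt b), Real.sq_sqrt ha, Real.sq_sqrt hb]

/-- The integers form a `(√2 - 1)`-quasi-straight sequence in the snowflaked Euclidean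
line `(ℝ, √|x - y|)`. -/
theorem int_isQuasiStraightSeq_snowflake :
    IsQuasiStraightSeq (Real.sqrt 2 - 1) (fun k : ℤ => SnowflakeLine.mk (k : ℝ)) := by
  refine ⟨fun hs => ?_, fun hs => ?_, fun k => ?_, fun i j k hij hjk => ?_⟩
  · obtain ⟨C, hC⟩ := SnowflakeLine.exists_abs_sub_le hs
    obtain ⟨n, hn⟩ := exists_nat_gt C
    have h := hC _ ⟨-n, by simp, rfl⟩ _ ⟨0, by simp, rfl⟩
    simp at h
    linarith
  · obtain ⟨C, hC⟩ := SnowflakeLine.exists_abs_sub_le hs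
    obtain ⟨n, hn⟩ := exists_nat_gt C
    have h := hC _ ⟨n, by simp, rfl⟩ _ ⟨0, by simp, rfl⟩
    simp at h
    linarith
  · simp [SnowflakeLine.dist_eq]
  · have hij' : (i : ℝ) ≤ j := by exact_mod_cast hij
    have hjk' : (j : ℝ) ≤ k := by exact_mod_cast hjk
    simp only [SnowflakeLine.dist_mk_of_le hij', SnowflakeLine.dist_mk_of_le hjk',
      SnowflakeLine.dist_mk_of_le (hij'.trans hjk')]
    have h := Real.sqrt_add_sqrt_le (sub_nonneg.mpr hij') (sub_nonneg.mpr hjk')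
    rw [show (j : ℝ) - i + (k - j) = k - i by ring] at h
    have h2 : (1 : ℝ) ≤ Real.sqrt 2 := Real.one_le_sqrt.mpr one_le_two
    linarith
end

section
/- Let (X,d) be a metric space, K ≥ 0, and ζ : ℤ → X a K-quasi-straight sequence. Let m, ℓ, n ∈ ℤ with m ≤ ℓ ≤ n and set o := ζ_ℓ. Let E, F ⊆ X be nonempty sets with E ⊆ B(ζ(ℤ_{≤m}), K) and F ⊆ B(ζ(ℤ_{≥n}), K), and write d_E(z) := inf{d(z,e) : e ∈ E} and d_F(z) := inf{d(z,f) : f ∈ F}. Then for every z ∈ X, d_E(z) + d_F(z) ≥ (2/(K+2))·d(o,z) − K(2K+5)/(K+2). -/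
open Metric

/-- If `E` lies in the `K`-neighborhood of `ζ(ℤ≤m)` and `F` in the `K`-neighborhood of
`ζ(ℤ≥n)` for a `K`-quasi-straight sequence `ζ` and `m ≤ ℓ ≤ n`, then, with `o = ζ ℓ`,
`d_E(z) + d_F(z) ≥ (2/(K+2)) d(o,z) - K(2K+5)/(K+2)` for every `z`. -/
theorem infDist_add_infDist_ge_of_quasiStraight
    {X : Type*} [MetricSpace X] (K : ℝ) (hK : 0 ≤ K)
    (ζ : ℤ → X) (hζ : IsQuasiStraightSeq K ζ)
    (m ℓ n : ℤ) (hmℓ : m ≤ ℓ) (hℓn : ℓ ≤ n)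
    (E F : Set X) (hE : E.Nonempty) (hF : F.Nonempty)
    (hEsub : E ⊆ ⋃ k : ℤ, ⋃ _ : k ≤ m, ball (ζ k) K)
    (hFsub : F ⊆ ⋃ k : ℤ, ⋃ _ : n ≤ k, ball (ζ k) K) :
    ∀ z : X, infDist z E + infDist z F ≥
      (2 / (K + 2)) * dist (ζ ℓ) z - K * (2 * K + 5) / (K + 2) := by
  intro z
  obtain ⟨-, -, -, hstraight⟩ := hζ
  have key : ∀ e ∈ E, ∀ f ∈ F,
      (2 / (K + 2)) * dist (ζ ℓ) z - K * (2 * K + 5) / (K + 2) ≤ dist z e + dist z f := by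
    intro e he f hf
    obtain ⟨i, him, hei⟩ := Set.mem_iUnion₂.1 (hEsub he)
    obtain ⟨k, hnk, hfk⟩ := Set.mem_iUnion₂.1 (hFsub hf)
    rw [mem_ball] at hei hfk
    have hal := hstraight i ℓ k (him.trans hmℓ) (hℓn.trans hnk)
    have hi : dist z (ζ i) ≤ dist z e + K := by linarith [dist_triangle z e (ζ i)]
    have hk : dist z (ζ k) ≤ dist z f + K := by linarith [dist_triangle z f (ζ k)]
    have hik : dist (ζ i) (ζ k) ≤ dist z e + dist z f + 2 * K := by
      linarith [dist_triangle_left (ζ i) (ζ k) z]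
    have hoi : dist (ζ ℓ) z ≤ dist (ζ i) (ζ ℓ) + dist z (ζ i) := by
      linarith [dist_triangle_left (ζ ℓ) z (ζ i), dist_comm z (ζ i)]
    have hok : dist (ζ ℓ) z ≤ dist (ζ ℓ) (ζ k) + dist z (ζ k) :=
      dist_triangle_right _ _ _
    have hmul := mul_le_mul_of_nonneg_left hik hK
    rw [div_mul_eq_mul_div, ← sub_div, div_le_iff₀ (by linarith)]
    linarith
  rw [ge_iff_le, ← sub_le_iff_le_add, le_infDist hE]
  intro e he
  rw [sub_le_comm, le_infDist hF]
  intro f hf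
  linarith [key e he f hf]
end

section
/- Let (X,d) be a metric space, K ≥ 0, and ζ : ℤ → X a K-quasi-straight sequence. Let m, ℓ, n ∈ ℤ with m ≤ ℓ ≤ n and set o := ζ_ℓ. Let x, y ∈ X be points with d(ζ_m, x) ≤ K and d(ζ_n, y) ≤ K. Let E, F ⊆ X be nonempty sets with E ⊆ B(ζ(ℤ_{≤m}), K) and F ⊆ B(ζ(ℤ_{≥n}), K), and write d_E(z) := inf{d(z,e) : e ∈ E} and d_F(z) := inf{d(z,f) : f ∈ F}. Then for every z ∈ X, d_E(z) + d_F(z) ≥ d(x,y)/(K+1) − (2K + 4K/(K+1)) − 2·d(o,z). -/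
open Metric

/-- If every point of `S` is `K`-close to some `p` with `d(a,o) ≤ (K+1) d(p,o) + K`, then
`d_S(z)` is bounded below in terms of `d(a,o)` and `d(o,z)`. -/
theorem le_infDist_of_dist_le {X : Type*} [MetricSpace X] {K : ℝ} (hK : 0 ≤ K) {a o : X}
    {S : Set X} (hS : S.Nonempty)
    (h : ∀ e ∈ S, ∃ p, dist e p ≤ K ∧ dist a o ≤ (K + 1) * dist p o + K) (z : X) :
    (dist a o - K) / (K + 1) - K - dist o z ≤ infDist z S := by
  rw [le_infDist hS]
  intro e he
  obtain ⟨p, hp, hao⟩ := h e he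
  have hpo : (dist a o - K) / (K + 1) ≤ dist p o := by
    rw [div_le_iff₀ (by linarith)]
    linarith
  have htri := dist_triangle4 p e z o
  rw [dist_comm p e, dist_comm e z, dist_comm z o] at htri
  linarith

/-- If `E` lies in the `K`-neighborhood of `ζ(ℤ≤m)`, `F` in the `K`-neighborhood of
`ζ(ℤ≥n)`, `x` is `K`-close to `ζ m`, and `y` is `K`-close to `ζ n`, for a `K`-quasi-straight
sequence `ζ` and `m ≤ ℓ ≤ n`, then with `o = ζ ℓ` one has
`d_E(z) + d_F(z) ≥ d(x,y)/(K+1) - (2K + 4K/(K+1)) - 2 d(o,z)` for every `z`. -/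
theorem infDist_add_infDist_ge_dist_of_quasiStraight
    {X : Type*} [MetricSpace X] (K : ℝ) (hK : 0 ≤ K)
    (ζ : ℤ → X) (hζ : IsQuasiStraightSeq K ζ)
    (m ℓ n : ℤ) (hmℓ : m ≤ ℓ) (hℓn : ℓ ≤ n)
    (x y : X) (hx : dist (ζ m) x ≤ K) (hy : dist (ζ n) y ≤ K)
    (E F : Set X) (hE : E.Nonempty) (hF : F.Nonempty)
    (hEsub : E ⊆ ⋃ k : ℤ, ⋃ _ : k ≤ m, ball (ζ k) K)
    (hFsub : F ⊆ ⋃ k : ℤ, ⋃ _ : n ≤ k, ball (ζ k) K) :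
    ∀ z : X, infDist z E + infDist z F ≥
      dist x y / (K + 1) - (2 * K + 4 * K / (K + 1)) - 2 * dist (ζ ℓ) z := by
  obtain ⟨-, -, -, hstr⟩ := hζ
  intro z
  have hEz := le_infDist_of_dist_le (a := ζ m) (o := ζ ℓ) hK hE (fun e he => by
    obtain ⟨i, hi, hei⟩ := Set.mem_iUnion₂.mp (hEsub he)
    refine ⟨ζ i, (mem_ball.mp hei).le, ?_⟩
    linarith [hstr i m ℓ hi hmℓ, dist_nonneg (x := ζ i) (y := ζ m)]) z
  have hFz := le_infDist_of_dist_le (a := ζ n) (o := ζ ℓ) hK hF (fun f hf => by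
    obtain ⟨j, hj, hfj⟩ := Set.mem_iUnion₂.mp (hFsub hf)
    refine ⟨ζ j, (mem_ball.mp hfj).le, ?_⟩
    rw [dist_comm (ζ n), dist_comm (ζ j)]
    linarith [hstr ℓ n j hℓn hj, dist_nonneg (x := ζ n) (y := ζ j)]) z
  have hxy : dist x y ≤ dist (ζ m) (ζ ℓ) + dist (ζ n) (ζ ℓ) + 2 * K := by
    have hxy₁ := dist_triangle4 x (ζ m) (ζ n) y
    have hxy₂ := dist_triangle_right (ζ m) (ζ n) (ζ ℓ)
    rw [dist_comm x (ζ m)] at hxy₁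
    linarith
  have hdiv : (dist x y - 4 * K) / (K + 1) ≤
      ((dist (ζ m) (ζ ℓ) - K) + (dist (ζ n) (ζ ℓ) - K)) / (K + 1) :=
    div_le_div_of_nonneg_right (by linarith) (by linarith)
  rw [sub_div, add_div] at hdiv
  linarith
end
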